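/- arXiv:2402.03065 — 3 statements merged into one kernel-verified Lean document; each statement's English description precedes it below -/
import Mathlib

section
/- Let T be a 2-tree on [n−1], suppose the Mandelstam invariants s are generic for T, and let x̂ ∈ U be a critical point of the scattering potential L_T. Then the determinant of the negated Hessian 𝓗(x̂) = −Hess(L_T)(x̂) factors as det 𝓗(x̂) = Π_{triangles {i,j,k} of T, i<j<k} ( [s_{{i,k}}]/p_{ik}(x̂)² + [s_{{j,k}}]/p_{jk}(x̂)² ). -/
namespace MinKin

noncomputable section

attribute [local instance] Classical.propDecidable

open scoped BigOperators

/-- First row of the 2×n matrix X, at column `j` (1-based). -/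
def colA (n j : ℕ) : ℂ := if j = n then 0 else 1

/-- Second row of X at column `j` (1-based): `(0,1,x_1,…,x_{n-3},1)`. -/
def colB (n : ℕ) (x : Fin (n - 3) → ℂ) (j : ℕ) : ℂ :=
  if j = 1 then 0
  else if j = 2 then 1
  else if j = n then 1
  else if h : j - 3 < n - 3 then x ⟨j - 3, h⟩ else 0

/-- The Plücker coordinate `p_{ij}(x)`, the 2×2 minor of X on columns i and j. -/
def pc (n : ℕ) (x : Fin (n - 3) → ℂ) (i j : ℕ) : ℂ :=
  colA n i * colB n x j - colA n j * colB n x i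

/-- The partial derivative `∂p_{ij}/∂x_m` (with `m : Fin (n-3)` zero-based, so that
the variable `x m` appears in column `(m:ℕ)+3` of X). -/
def dpc (n : ℕ) (i j : ℕ) (m : Fin (n - 3)) : ℂ :=
  colA n i * (if j = (m : ℕ) + 3 then (1 : ℂ) else 0)
    - colA n j * (if i = (m : ℕ) + 3 then (1 : ℂ) else 0)

/-- The index set `S = {(i,j) : 1 ≤ i < j ≤ n-1, (i,j) ≠ (1,2)}`. -/
def Sfin (n : ℕ) : Finset (ℕ × ℕ) :=
  ((Finset.Icc 1 (n - 1)) ×ˢ (Finset.Icc 1 (n - 1))).filter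
    (fun e => e.1 < e.2 ∧ e ≠ (1, 2))

/-- The domain `U = {x : p_{ij}(x) ≠ 0 for all (i,j) ∈ S}`. -/
def Udom (n : ℕ) : Set (Fin (n - 3) → ℂ) :=
  {x | ∀ e ∈ Sfin n, pc n x e.1 e.2 ≠ 0}

/-- `x` is a critical point of `L_{T₀} = Σ_{e ∈ T₀} s_e · log p_e`. -/
def IsCrit (n : ℕ) (T₀ : Finset (ℕ × ℕ)) (s : ℕ × ℕ → ℂ) (x : Fin (n - 3) → ℂ) : Prop :=
  ∀ m : Fin (n - 3), ∑ e ∈ T₀, s e * dpc n e.1 e.2 m / pc n x e.1 e.2 = 0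

/-- Edge sets built inductively from the parent choices `par`. -/
def edgesUpTo (par : ℕ → ℕ × ℕ) : ℕ → Finset (ℕ × ℕ)
  | 0 => {(1, 2)}
  | k + 1 =>
      if k + 1 < 3 then {(1, 2)}
      else edgesUpTo par k ∪ {((par (k + 1)).1, k + 1), ((par (k + 1)).2, k + 1)}

/-- A 2-tree on `[n-1]`: for each `k = 3,…,n-1` an already-present edge
`par k = (i_k, j_k)` with `i_k < j_k ≤ k-1` is chosen, and the edges
`(i_k, k)` and `(j_k, k)` are added. -/
structure TwoTree (n : ℕ) : Type where
  par : ℕ → ℕ × ℕ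
  lt : ∀ k, 3 ≤ k → k ≤ n - 1 → (par k).1 < (par k).2 ∧ (par k).2 < k
  mem : ∀ k, 3 ≤ k → k ≤ n - 1 → par k ∈ edgesUpTo par (k - 1)

/-- The edge set of a 2-tree. -/
def TwoTree.edges {n : ℕ} (T : TwoTree n) : Finset (ℕ × ℕ) := edgesUpTo T.par (n - 1)

/-- A finite edge set is a 2-tree on `[n-1]`. -/
def IsTwoTree (n : ℕ) (E : Finset (ℕ × ℕ)) : Prop := ∃ T : TwoTree n, T.edges = E

/-- `c` is a child of `e` in the 2-tree `T`. -/
def Child (n : ℕ) (T : TwoTree n) (e c : ℕ × ℕ) : Prop :=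
  ∃ k, 3 ≤ k ∧ k ≤ n - 1 ∧ T.par k = e ∧ (c = (e.1, k) ∨ c = (e.2, k))

/-- The set `dec(e)` of descendants of the edge `e` (including `e` itself). -/
def dec (n : ℕ) (T : TwoTree n) (e : ℕ × ℕ) : Finset (ℕ × ℕ) :=
  T.edges.filter (fun f => Relation.ReflTransGen (Child n T) e f)

/-- The bracket `[s_e] = Σ_{f ∈ dec(e)} s_f`. -/
def brk (n : ℕ) (T : TwoTree n) (s : ℕ × ℕ → ℂ) (e : ℕ × ℕ) : ℂ :=
  ∑ f ∈ dec n T e, s f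

/-- The Mandelstam invariants `s` are generic for `T`. -/
def Generic (n : ℕ) (T : TwoTree n) (s : ℕ × ℕ → ℂ) : Prop :=
  ∀ k, 3 ≤ k → k ≤ n - 1 →
    brk n T s ((T.par k).1, k) ≠ 0 ∧ brk n T s ((T.par k).2, k) ≠ 0 ∧
      brk n T s ((T.par k).1, k) + brk n T s ((T.par k).2, k) ≠ 0

/-- `a_e = |dec(e)|`. -/
def aA (n : ℕ) (T : TwoTree n) (e : ℕ × ℕ) : ℕ := (dec n T e).card

/-- `v_T(e)`: the number of triangles of `T` containing the edge `e`. -/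
def vT (n : ℕ) (T : TwoTree n) (e : ℕ × ℕ) : ℕ :=
  ((Finset.Icc 3 (n - 1)).filter
    (fun k => e = T.par k ∨ e = ((T.par k).1, k) ∨ e = ((T.par k).2, k))).card

/-- The Horn product `P_e(s)`: over all ancestral triangles `{i,j,k}` of `e`, the
factor `[s_c]/([s_{(i,k)}]+[s_{(j,k)}])` where `c` is the child containing `e`
among its descendants. -/
def hornP (n : ℕ) (T : TwoTree n) (s : ℕ × ℕ → ℂ) (e : ℕ × ℕ) : ℂ :=
  ∏ k ∈ Finset.Icc 3 (n - 1),
    (if e ∈ dec n T ((T.par k).1, k) then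
        brk n T s ((T.par k).1, k)
          / (brk n T s ((T.par k).1, k) + brk n T s ((T.par k).2, k))
      else if e ∈ dec n T ((T.par k).2, k) then
        brk n T s ((T.par k).2, k)
          / (brk n T s ((T.par k).1, k) + brk n T s ((T.par k).2, k))
      else 1)

/-- Auxiliary recursion for the signs `ε_e`. -/
def epsAux (par : ℕ → ℕ × ℕ) : ℕ → ℕ × ℕ → ℂ
  | 0, _ => 1
  | k + 1, e =>
      if e = (1, 2) then 1
      else if e = ((par (k + 1)).1, k + 1) then epsAux par k (par (k + 1))
      else if e = ((par (k + 1)).2, k + 1) then -(epsAux par k (par (k + 1)))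
      else epsAux par k e

/-- The sign `ε_e ∈ {1,-1}`: `ε_{(1,2)} = 1`, `ε_{(i,k)} = ε_{(i,j)}`,
`ε_{(j,k)} = -ε_{(i,j)}` for each triangle `{i,j,k}`. -/
def eps (n : ℕ) (T : TwoTree n) (e : ℕ × ℕ) : ℂ := epsAux T.par (n - 1) e

/-- The negated Hessian matrix `𝓗(x) = -Hess(L_{T₀})(x)`. -/
def negHess (n : ℕ) (T₀ : Finset (ℕ × ℕ)) (s : ℕ × ℕ → ℂ) (x : Fin (n - 3) → ℂ) :
    Matrix (Fin (n - 3)) (Fin (n - 3)) ℂ :=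
  Matrix.of fun (l m : Fin (n - 3)) =>
    ∑ e ∈ T₀, s e * dpc n e.1 e.2 l * dpc n e.1 e.2 m / pc n x e.1 e.2 ^ 2

/-- The on-shell diagram of `T`: the triangles of `T` together with `(1,2,n)`. -/
def triples (n : ℕ) (T : TwoTree n) : Finset (ℕ × ℕ × ℕ) :=
  insert (1, 2, n) ((Finset.Icc 3 (n - 1)).image fun k => ((T.par k).1, (T.par k).2, k))

/-- The edge `e` is contained in the triple `t`. -/
def inTriple (e : ℕ × ℕ) (t : ℕ × ℕ × ℕ) : Prop :=
  e = (t.1, t.2.1) ∨ e = (t.1, t.2.2) ∨ e = (t.2.1, t.2.2)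

/-- `ṽ(e)`: the number of triples of the on-shell diagram containing `e`. -/
def vTil (n : ℕ) (T : TwoTree n) (e : ℕ × ℕ) : ℕ :=
  ((triples n T).filter (inTriple e)).card

/-- The edges contained in at least one triple of the on-shell diagram. -/
def diagEdges (n : ℕ) (T : TwoTree n) : Finset (ℕ × ℕ) :=
  (triples n T).biUnion fun t => {(t.1, t.2.1), (t.1, t.2.2), (t.2.1, t.2.2)}

/-- The CHY integrand `I_T(x) = Π_e p_e(x)^{ṽ(e)-2}`. -/
def integrand (n : ℕ) (T : TwoTree n) (x : Fin (n - 3) → ℂ) : ℂ :=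
  ∏ e ∈ diagEdges n T, pc n x e.1 e.2 ^ ((vTil n T e : ℤ) - 2)

/-- The Horn matrix `H_T`: rows come in consecutive triples indexed by the triangles
(in order k = 3,…,n-1), columns indexed by the non-initial edges of `T`
(in order (i_3,3),(j_3,3),(i_4,4),(j_4,4),…). -/
def HornMat (n : ℕ) (T : TwoTree n) : Matrix (Fin (3 * n - 9)) (Fin (2 * n - 6)) ℤ :=
  Matrix.of fun (ρ : Fin (3 * n - 9)) (c : Fin (2 * n - 6)) =>
    let k := (ρ : ℕ) / 3 + 3
    let c1 : ℕ × ℕ := ((T.par k).1, k)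
    let c2 : ℕ × ℕ := ((T.par k).2, k)
    let kc := (c : ℕ) / 2 + 3
    let e : ℕ × ℕ := if (c : ℕ) % 2 = 0 then ((T.par kc).1, kc) else ((T.par kc).2, kc)
    if (ρ : ℕ) % 3 = 0 then (if e ∈ dec n T c1 then 1 else 0)
    else if (ρ : ℕ) % 3 = 1 then (if e ∈ dec n T c2 then 1 else 0)
    else (if e ∈ dec n T c1 ∨ e ∈ dec n T c2 then -1 else 0)

/-- The matrix `A` whose r-th row has 1 in columns 3r-2, 3r-1, 3r (1-based). -/
def Amat (n : ℕ) : Matrix (Fin (n - 3)) (Fin (3 * n - 9)) ℤ :=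
  Matrix.of fun (r : Fin (n - 3)) (c : Fin (3 * n - 9)) =>
    if (c : ℕ) / 3 = (r : ℕ) then 1 else 0

/-- Polynomial version of the first row of X. -/
def colAP (n : ℕ) (j : ℕ) : MvPolynomial (Fin (n - 3)) ℂ := if j = n then 0 else 1

/-- Polynomial version of the second row of X. -/
def colBP (n : ℕ) (j : ℕ) : MvPolynomial (Fin (n - 3)) ℂ :=
  if j = 1 then 0
  else if j = 2 then 1
  else if j = n then 1
  else if h : j - 3 < n - 3 then MvPolynomial.X ⟨j - 3, h⟩ else 0

/-- The Plücker coordinate `p_{ij}` as a polynomial in `ℂ[x_1,…,x_{n-3}]`. -/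
def pcP (n : ℕ) (i j : ℕ) : MvPolynomial (Fin (n - 3)) ℂ :=
  colAP n i * colBP n j - colAP n j * colBP n i

/-- The r-th triple (0-based row index) of the on-shell diagram of `T`. -/
def tripleOf (n : ℕ) (T : TwoTree n) (r : ℕ) : ℕ × ℕ × ℕ :=
  if r + 3 ≤ n - 1 then ((T.par (r + 3)).1, (T.par (r + 3)).2, r + 3) else (1, 2, n)

/-- The matrix `M_T` over `ℂ[x_1,…,x_{n-3}]`, whose row indexed by a triple
`{i,j,k}` (i<j<k) is `p_{jk}·e_i - p_{ik}·e_j + p_{ij}·e_k`. -/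
def Mmat (n : ℕ) (T : TwoTree n) :
    Matrix (Fin (n - 2)) (Fin n) (MvPolynomial (Fin (n - 3)) ℂ) :=
  Matrix.of fun (r : Fin (n - 2)) (c : Fin n) =>
    if (c : ℕ) + 1 = (tripleOf n T r).1 then
      pcP n (tripleOf n T r).2.1 (tripleOf n T r).2.2
    else if (c : ℕ) + 1 = (tripleOf n T r).2.1 then
      -pcP n (tripleOf n T r).1 (tripleOf n T r).2.2
    else if (c : ℕ) + 1 = (tripleOf n T r).2.2 then
      pcP n (tripleOf n T r).1 (tripleOf n T r).2.1
    else 0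

/-- The matrix `M_T` evaluated at a point `x ∈ ℂ^{n-3}`. -/
def MmatC (n : ℕ) (T : TwoTree n) (x : Fin (n - 3) → ℂ) : Matrix (Fin (n - 2)) (Fin n) ℂ :=
  Matrix.of fun (r : Fin (n - 2)) (c : Fin n) =>
    if (c : ℕ) + 1 = (tripleOf n T r).1 then
      pc n x (tripleOf n T r).2.1 (tripleOf n T r).2.2
    else if (c : ℕ) + 1 = (tripleOf n T r).2.1 then
      -pc n x (tripleOf n T r).1 (tripleOf n T r).2.2
    else if (c : ℕ) + 1 = (tripleOf n T r).2.2 then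
      pc n x (tripleOf n T r).1 (tripleOf n T r).2.1
    else 0

/-- The 2×n matrix X evaluated at `x`. -/
def Xmat (n : ℕ) (x : Fin (n - 3) → ℂ) : Matrix (Fin 2) (Fin n) ℂ :=
  Matrix.of fun (r : Fin 2) (c : Fin n) =>
    if r = 0 then colA n ((c : ℕ) + 1) else colB n x ((c : ℕ) + 1)

/-- The monotone embedding `Fin (n-2) → Fin n` skipping the (0-based) positions
`a < b`. -/
def delCols (n a b : ℕ) (d : Fin (n - 2)) : Fin n :=
  ⟨if (d : ℕ) < a then (d : ℕ) else if (d : ℕ) + 1 < b then (d : ℕ) + 1 else (d : ℕ) + 2, by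
    have := d.isLt; split_ifs <;> omega⟩

/-- The maximal minor of `M_T` obtained by deleting columns `i < j` (1-based). -/
def maxMinor (n : ℕ) (T : TwoTree n) (i j : ℕ) : MvPolynomial (Fin (n - 3)) ℂ :=
  Matrix.det (Matrix.of fun (r d : Fin (n - 2)) => Mmat n T r (delCols n (i - 1) (j - 1) d))

/-- `Δ_T = Π_e p_e^{ṽ(e)-1}`. -/
def DeltaT (n : ℕ) (T : TwoTree n) : MvPolynomial (Fin (n - 3)) ℂ :=
  ∏ e ∈ diagEdges n T, pcP n e.1 e.2 ^ (vTil n T e - 1)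

/-- `T₀` has, for generic coefficients, exactly one critical point in `U`. -/
def UniqueCritGeneric (n : ℕ) (T₀ : Finset (ℕ × ℕ)) : Prop :=
  ∃ g : MvPolynomial {e : ℕ × ℕ // e ∈ T₀} ℂ, g ≠ 0 ∧
    ∀ s : ℕ × ℕ → ℂ, MvPolynomial.eval (fun v => s v.1) g ≠ 0 →
      ∃! x : Fin (n - 3) → ℂ, x ∈ Udom n ∧ IsCrit n T₀ s x

/-- `T₀ ⊆ S` exhibits minimal kinematics. -/
def ExhibitsMinKin (n : ℕ) (T₀ : Finset (ℕ × ℕ)) : Prop :=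
  T₀ ⊆ Sfin n ∧ UniqueCritGeneric n T₀ ∧
    ∀ T₁ : Finset (ℕ × ℕ), T₁ ⊆ Sfin n → T₀ ⊆ T₁ → UniqueCritGeneric n T₁ → T₁ = T₀

theorem mem_edgesUpTo (par : ℕ → ℕ × ℕ) (m : ℕ) (e : ℕ × ℕ) :
    e ∈ edgesUpTo par m ↔
      e = (1, 2) ∨ ∃ k, 3 ≤ k ∧ k ≤ m ∧ (e = ((par k).1, k) ∨ e = ((par k).2, k)) := by
  induction m with
  | zero =>
    simp only [edgesUpTo, Finset.mem_singleton]
    refine ⟨Or.inl, ?_⟩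
    rintro (h | ⟨k, h3, h0, -⟩)
    · exact h
    · omega
  | succ m ih =>
    rw [edgesUpTo]
    split_ifs with hm
    · rw [Finset.mem_singleton]
      refine ⟨Or.inl, ?_⟩
      rintro (h | ⟨k, h3, h0, -⟩)
      · exact h
      · omega
    · rw [Finset.mem_union, ih, Finset.mem_insert, Finset.mem_singleton]
      constructor
      · rintro ((h | ⟨k, h3, hk, h⟩) | h)
        · exact Or.inl h
        · exact Or.inr ⟨k, h3, by omega, h⟩
        · exact Or.inr ⟨m + 1, by omega, le_rfl, h⟩
      · rintro (h | ⟨k, h3, hk, h⟩)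
        · exact Or.inl (Or.inl h)
        · rcases Nat.lt_or_ge m k with hmk | hmk
          · obtain rfl : k = m + 1 := by omega
            exact Or.inr h
          · exact Or.inl (Or.inr ⟨k, h3, hmk, h⟩)

namespace TwoTree

variable {n : ℕ} (T : TwoTree n)

theorem mem_erase_edges (e : ℕ × ℕ) :
    e ∈ T.edges.erase (1, 2) ↔
      3 ≤ e.2 ∧ e.2 ≤ n - 1 ∧ (e.1 = (T.par e.2).1 ∨ e.1 = (T.par e.2).2) := by
  rw [Finset.mem_erase, TwoTree.edges, mem_edgesUpTo]
  constructor
  · rintro ⟨h, h' | ⟨k, h3, hk, rfl | rfl⟩⟩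
    · exact absurd h' h
    · exact ⟨h3, hk, Or.inl rfl⟩
    · exact ⟨h3, hk, Or.inr rfl⟩
  · rintro ⟨h3, hk, h⟩
    refine ⟨fun h' => by simp [h'] at h3, Or.inr ⟨e.2, h3, hk, ?_⟩⟩
    exact h.imp (fun h => Prod.ext h rfl) (fun h => Prod.ext h rfl)

theorem par_mem_edges {k : ℕ} (h3 : 3 ≤ k) (hk : k ≤ n - 1) : T.par k ∈ T.edges := by
  have h := T.mem k h3 hk
  rw [mem_edgesUpTo] at h
  rw [TwoTree.edges, mem_edgesUpTo]
  refine h.imp_right ?_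
  rintro ⟨l, h3, hl, h⟩
  exact ⟨l, h3, by omega, h⟩

theorem one_le_fst {e : ℕ × ℕ} (he : e ∈ T.edges) : 1 ≤ e.1 := by
  induction hm : e.2 using Nat.strong_induction_on generalizing e with
  | _ m ih =>
    subst hm
    by_cases h12 : e = (1, 2)
    · simp [h12]
    · obtain ⟨h3, hk, h⟩ := (T.mem_erase_edges e).1 (Finset.mem_erase.2 ⟨h12, he⟩)
      have hlt := T.lt _ h3 hk
      have := ih _ hlt.2 (T.par_mem_edges h3 hk) rfl
      omega

theorem child_iff (e c : ℕ × ℕ) :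
    Child n T e c ↔ c ∈ T.edges.erase (1, 2) ∧ T.par c.2 = e := by
  rw [T.mem_erase_edges]
  constructor
  · rintro ⟨k, h3, hk, rfl, rfl | rfl⟩
    · exact ⟨⟨h3, hk, Or.inl rfl⟩, rfl⟩
    · exact ⟨⟨h3, hk, Or.inr rfl⟩, rfl⟩
  · rintro ⟨⟨h3, hk, h⟩, rfl⟩
    exact ⟨c.2, h3, hk, rfl, h.imp (fun h => Prod.ext h rfl) (fun h => Prod.ext h rfl)⟩

theorem snd_le_of_descendant {e f : ℕ × ℕ} (h : Relation.ReflTransGen (Child n T) e f) :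
    e.2 ≤ f.2 := by
  induction h with
  | refl => exact le_rfl
  | tail _ h ih =>
    rw [child_iff, mem_erase_edges] at h
    obtain ⟨⟨h3, hk, -⟩, rfl⟩ := h
    exact ih.trans (T.lt _ h3 hk).2.le

/-- A descendant other than the root edge is either the edge itself or a descendant through
its parent. -/
theorem descendant_iff {c f : ℕ × ℕ} (hf : f ∈ T.edges.erase (1, 2)) :
    Relation.ReflTransGen (Child n T) c f ↔
      f = c ∨ Relation.ReflTransGen (Child n T) c (T.par f.2) := by
  rw [Relation.ReflTransGen.cases_tail_iff]
  refine or_congr Iff.rfl ⟨?_, fun h => ⟨_, h, (T.child_iff _ _).2 ⟨hf, rfl⟩⟩⟩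
  rintro ⟨b, hb, h⟩
  rw [child_iff] at h
  rwa [h.2]

/-- Summing the increments of `g` along the ancestors of `f` telescopes. -/
theorem sum_ancestors (g : ℕ × ℕ → ℂ) {f : ℕ × ℕ} (hf : f ∈ T.edges) :
    ∑ c ∈ T.edges.erase (1, 2) with Relation.ReflTransGen (Child n T) c f,
      (g c - g (T.par c.2)) = g f - g (1, 2) := by
  induction hm : f.2 using Nat.strong_induction_on generalizing f with
  | _ m ih =>
    subst hm
    by_cases h12 : f = (1, 2)
    · subst h12
      rw [sub_self, Finset.sum_eq_zero]
      intro c hc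
      rw [Finset.mem_filter, mem_erase_edges] at hc
      have := T.snd_le_of_descendant hc.2
      simp only at this
      omega
    · have hf' := Finset.mem_erase.2 ⟨h12, hf⟩
      obtain ⟨h3, hk, h⟩ := (T.mem_erase_edges f).1 hf'
      have hlt := (T.lt _ h3 hk).2
      have hset : (T.edges.erase (1, 2)).filter
            (fun c => Relation.ReflTransGen (Child n T) c f) =
          insert f ((T.edges.erase (1, 2)).filter
            (fun c => Relation.ReflTransGen (Child n T) c (T.par f.2))) := by
        ext c
        rw [Finset.mem_insert, Finset.mem_filter, Finset.mem_filter, T.descendant_iff hf']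
        constructor
        · rintro ⟨hc, rfl | h⟩
          · exact Or.inl rfl
          · exact Or.inr ⟨hc, h⟩
        · rintro (rfl | ⟨hc, h⟩)
          · exact ⟨hf', Or.inl rfl⟩
          · exact ⟨hc, Or.inr h⟩
      rw [hset, Finset.sum_insert, ih _ hlt (T.par_mem_edges h3 hk) rfl]
      · ring
      · intro hmem
        have := T.snd_le_of_descendant (Finset.mem_filter.1 hmem).2
        omega

theorem sum_brk_mul (s g : ℕ × ℕ → ℂ) (hg : g (1, 2) = 0) :
    ∑ c ∈ T.edges.erase (1, 2), brk n T s c * (g c - g (T.par c.2)) =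
      ∑ f ∈ T.edges.erase (1, 2), s f * g f := by
  have hroot : ∑ f ∈ T.edges.erase (1, 2), s f * g f = ∑ f ∈ T.edges, s f * g f :=
    Finset.sum_erase _ (by rw [hg, mul_zero])
  simp only [hroot, brk, dec, Finset.sum_filter, Finset.sum_mul, ite_mul, zero_mul]
  rw [Finset.sum_comm]
  refine Finset.sum_congr rfl fun f hf => ?_
  have h := T.sum_ancestors g hf
  rw [hg, sub_zero, Finset.sum_filter] at h
  rw [← h, Finset.mul_sum]
  exact Finset.sum_congr rfl fun c _ => by rw [mul_ite, mul_zero]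

theorem sum_erase_edges (F : ℕ × ℕ → ℂ) :
    ∑ e ∈ T.edges.erase (1, 2), F e =
      ∑ k ∈ Finset.Icc 3 (n - 1), (F ((T.par k).1, k) + F ((T.par k).2, k)) := by
  rw [← Finset.sum_fiberwise_of_maps_to (t := Finset.Icc 3 (n - 1)) (g := Prod.snd)
    (fun e he => by
      obtain ⟨h3, hk, -⟩ := (T.mem_erase_edges e).1 he
      exact Finset.mem_Icc.2 ⟨h3, hk⟩)]
  refine Finset.sum_congr rfl fun k hk => ?_
  obtain ⟨h3, hk⟩ := Finset.mem_Icc.1 hk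
  have hset : (T.edges.erase (1, 2)).filter (fun e => e.2 = k) =
      {((T.par k).1, k), ((T.par k).2, k)} := by
    ext ⟨a, b⟩
    rw [Finset.mem_filter, mem_erase_edges, Finset.mem_insert, Finset.mem_singleton,
      Prod.mk.injEq, Prod.mk.injEq]
    constructor
    · rintro ⟨⟨-, -, h⟩, rfl⟩
      exact h.imp (fun h => ⟨h, rfl⟩) (fun h => ⟨h, rfl⟩)
    · rintro (⟨rfl, rfl⟩ | ⟨rfl, rfl⟩)
      · exact ⟨⟨h3, hk, Or.inl rfl⟩, rfl⟩
      · exact ⟨⟨h3, hk, Or.inr rfl⟩, rfl⟩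
  rw [hset, Finset.sum_pair]
  intro h
  exact (T.lt k h3 hk).1.ne (Prod.mk.inj h).1

/-- Summation by parts: an edge sum rewritten as a sum over triangles with bracket weights. -/
theorem sum_edges_eq_sum_triangles (s g : ℕ × ℕ → ℂ) (hg : g (1, 2) = 0) :
    ∑ e ∈ T.edges.erase (1, 2), s e * g e =
      ∑ k ∈ Finset.Icc 3 (n - 1),
        (brk n T s ((T.par k).1, k) * (g ((T.par k).1, k) - g (T.par k)) +
          brk n T s ((T.par k).2, k) * (g ((T.par k).2, k) - g (T.par k))) := by
  rw [← T.sum_brk_mul s g hg, T.sum_erase_edges]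

theorem pc_ne_zero {x : Fin (n - 3) → ℂ} (hx : x ∈ Udom n) (hn : 4 ≤ n) {e : ℕ × ℕ}
    (he : e ∈ T.edges) : pc n x e.1 e.2 ≠ 0 := by
  by_cases h12 : e = (1, 2)
  · subst h12
    have h1 : 1 ≠ n := by omega
    have h2 : 2 ≠ n := by omega
    simp [pc, colA, colB, h1, h2]
  · obtain ⟨h3, hk, h⟩ := (T.mem_erase_edges e).1 (Finset.mem_erase.2 ⟨h12, he⟩)
    have hlt := T.lt _ h3 hk
    have h1 := T.one_le_fst he
    apply hx
    simp only [Sfin, Finset.mem_filter, Finset.mem_product, Finset.mem_Icc]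
    exact ⟨⟨by omega, by omega⟩, by omega, h12⟩

/-- The linear form `v ↦ (v_k - v_i) - (p_{ik}/p_{ij}) (v_j - v_i)` attached to the triangle
`{i,j,k}`, evaluated at the `m`-th coordinate vector. -/
def triangleForm (x : Fin (n - 3) → ℂ) (k : ℕ) (m : Fin (n - 3)) : ℂ :=
  dpc n (T.par k).1 k m
    - pc n x (T.par k).1 k / pc n x (T.par k).1 (T.par k).2 * dpc n (T.par k).1 (T.par k).2 m

/-- The matrix of the triangle forms. -/
def triangleMat (x : Fin (n - 3) → ℂ) : Matrix (Fin (n - 3)) (Fin (n - 3)) ℂ :=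
  Matrix.of fun r m => T.triangleForm x ((r : ℕ) + 3) m

theorem det_triangleMat (x : Fin (n - 3) → ℂ) : (T.triangleMat x).det = 1 := by
  have hlt : ∀ r : Fin (n - 3), _ := fun r => T.lt ((r : ℕ) + 3) (by omega) (by omega)
  rw [Matrix.det_of_isLowerTriangular]
  · refine Finset.prod_eq_one fun r _ => ?_
    have h1 : (T.par ((r : ℕ) + 3)).1 ≠ (r : ℕ) + 3 := by have := hlt r; omega
    have h2 : (T.par ((r : ℕ) + 3)).2 ≠ (r : ℕ) + 3 := by have := hlt r; omega
    have h3 : (T.par ((r : ℕ) + 3)).1 ≠ n := by have := hlt r; omega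
    simp [triangleMat, triangleForm, dpc, colA, h1, h2, h3]
  · intro r m hrm
    have hrm' : (r : ℕ) < m := by simpa using hrm
    have h0 : (r : ℕ) ≠ (m : ℕ) := by omega
    have h1 : (T.par ((r : ℕ) + 3)).1 ≠ (m : ℕ) + 3 := by have := hlt r; omega
    have h2 : (T.par ((r : ℕ) + 3)).2 ≠ (m : ℕ) + 3 := by have := hlt r; omega
    simp [triangleMat, triangleForm, dpc, h0, h1, h2]

theorem dlog_child {x : Fin (n - 3) → ℂ} (hx : x ∈ Udom n) (hn : 4 ≤ n) {k : ℕ}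
    (h3 : 3 ≤ k) (hk : k ≤ n - 1) {a : ℕ} (ha : a = (T.par k).1 ∨ a = (T.par k).2)
    (m : Fin (n - 3)) :
    dpc n a k m / pc n x a k =
      T.triangleForm x k m / pc n x a k
        + dpc n (T.par k).1 (T.par k).2 m / pc n x (T.par k).1 (T.par k).2 := by
  have hp := T.pc_ne_zero hx hn (T.par_mem_edges h3 hk)
  have hc := T.pc_ne_zero hx hn
    (Finset.mem_of_mem_erase ((T.mem_erase_edges (a, k)).2 ⟨h3, hk, ha⟩))
  have hlt := T.lt k h3 hk
  have hi : (T.par k).1 ≠ n := by omega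
  have hj : (T.par k).2 ≠ n := by omega
  have hkn : k ≠ n := by omega
  rw [← sub_eq_iff_eq_add, div_sub_div _ _ hc hp, div_eq_div_iff (mul_ne_zero hc hp) hc]
  have hform : T.triangleForm x k m * pc n x (T.par k).1 (T.par k).2 =
      dpc n (T.par k).1 k m * pc n x (T.par k).1 (T.par k).2
        - pc n x (T.par k).1 k * dpc n (T.par k).1 (T.par k).2 m := by
    rw [triangleForm]
    field_simp
  have hmul : dpc n a k m * pc n x (T.par k).1 (T.par k).2
        - pc n x a k * dpc n (T.par k).1 (T.par k).2 m =
      T.triangleForm x k m * pc n x (T.par k).1 (T.par k).2 := by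
    rw [hform]
    rcases ha with rfl | rfl
    · rfl
    · simp only [pc, dpc, colA, if_neg hi, if_neg hj, if_neg hkn]
      ring
  rw [hmul]
  ring

theorem dpc_root (m : Fin (n - 3)) : dpc n 1 2 m = 0 := by
  simp [dpc]

@[to_additive]
theorem prod_Icc_eq_prod_fin {M : Type*} [CommMonoid M] (n : ℕ) (F : ℕ → M) :
    ∏ k ∈ Finset.Icc 3 (n - 1), F k = ∏ r : Fin (n - 3), F ((r : ℕ) + 3) := by
  have hset : Finset.Icc 3 (n - 1) = Finset.Ico 3 n := by
    ext k
    simp only [Finset.mem_Icc, Finset.mem_Ico]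
    omega
  rw [hset, Finset.prod_Ico_eq_prod_range, Fin.prod_univ_eq_prod_range (fun i => F (i + 3))]
  exact Finset.prod_congr rfl fun i _ => by rw [add_comm]

/-- The critical equations in triangular form: `[s_{ik}]/p_{ik} + [s_{jk}]/p_{jk} = 0`. -/
theorem critical_triangle {x : Fin (n - 3) → ℂ} (hx : x ∈ Udom n) (hn : 4 ≤ n)
    {s : ℕ × ℕ → ℂ} (hc : IsCrit n (T.edges.erase (1, 2)) s x) (r : Fin (n - 3)) :
    brk n T s ((T.par (r + 3)).1, r + 3) / pc n x (T.par (r + 3)).1 (r + 3)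
      + brk n T s ((T.par (r + 3)).2, r + 3) / pc n x (T.par (r + 3)).2 (r + 3) = 0 := by
  set ρ : Fin (n - 3) → ℂ := fun r =>
    brk n T s ((T.par (r + 3)).1, r + 3) / pc n x (T.par (r + 3)).1 (r + 3)
      + brk n T s ((T.par (r + 3)).2, r + 3) / pc n x (T.par (r + 3)).2 (r + 3) with hρ
  suffices h : ρ = 0 from congrFun h r
  refine Matrix.eq_zero_of_vecMul_eq_zero (M := T.triangleMat x)
    (by rw [T.det_triangleMat]; exact one_ne_zero) ?_
  ext m
  have h := hc m
  simp only [mul_div_assoc] at h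
  rw [T.sum_edges_eq_sum_triangles s (fun e => dpc n e.1 e.2 m / pc n x e.1 e.2)
    (by simp only [dpc_root, zero_div]), sum_Icc_eq_sum_fin] at h
  rw [Pi.zero_apply, ← h]
  rw [Matrix.vecMul, dotProduct]
  refine Finset.sum_congr rfl fun r _ => ?_
  dsimp only
  rw [T.dlog_child hx hn (by omega) (by omega) (Or.inl rfl),
    T.dlog_child hx hn (by omega) (by omega) (Or.inr rfl)]
  simp only [hρ, triangleMat, Matrix.of_apply]
  ring

/-- At a critical point the triangle forms diagonalise the negated Hessian. -/
theorem negHess_eq {x : Fin (n - 3) → ℂ} (hx : x ∈ Udom n) (hn : 4 ≤ n)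
    {s : ℕ × ℕ → ℂ} (hc : IsCrit n (T.edges.erase (1, 2)) s x) :
    negHess n (T.edges.erase (1, 2)) s x =
      (T.triangleMat x).transpose * Matrix.diagonal (fun r : Fin (n - 3) =>
        brk n T s ((T.par (r + 3)).1, r + 3) / pc n x (T.par (r + 3)).1 (r + 3) ^ 2
          + brk n T s ((T.par (r + 3)).2, r + 3) / pc n x (T.par (r + 3)).2 (r + 3) ^ 2) *
        T.triangleMat x := by
  ext l m
  rw [Matrix.mul_apply]
  simp only [Matrix.mul_diagonal, Matrix.transpose_apply, triangleMat, Matrix.of_apply, negHess]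
  have h := T.sum_edges_eq_sum_triangles s
    (fun e => dpc n e.1 e.2 l / pc n x e.1 e.2 * (dpc n e.1 e.2 m / pc n x e.1 e.2))
    (by simp only [dpc_root, zero_div, zero_mul])
  rw [sum_Icc_eq_sum_fin] at h
  refine Eq.trans (Finset.sum_congr rfl fun e _ => ?_) (h.trans
    (Finset.sum_congr rfl fun r _ => ?_))
  · rw [div_mul_div_comm, ← sq, mul_assoc, mul_div_assoc]
  · have hr := T.critical_triangle hx hn hc r
    dsimp only
    rw [T.dlog_child hx hn (by omega) (by omega) (Or.inl rfl),
      T.dlog_child hx hn (by omega) (by omega) (Or.inr rfl),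
      T.dlog_child hx hn (by omega) (by omega) (Or.inl rfl),
      T.dlog_child hx hn (by omega) (by omega) (Or.inr rfl)]
    linear_combination (T.triangleForm x (r + 3) l *
        (dpc n (T.par (r + 3)).1 (T.par (r + 3)).2 m /
          pc n x (T.par (r + 3)).1 (T.par (r + 3)).2) +
      T.triangleForm x (r + 3) m *
        (dpc n (T.par (r + 3)).1 (T.par (r + 3)).2 l /
          pc n x (T.par (r + 3)).1 (T.par (r + 3)).2)) * hr

end TwoTree

/-- the determinant of the negated Hessian at a critical point
factors as the product over triangles of [s_{ik}]/p_{ik}² + [s_{jk}]/p_{jk}². -/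
theorem hessian_determinant_factors (n : ℕ) (hn : 4 ≤ n) (T : TwoTree n)
    (s : ℕ × ℕ → ℂ) (hs : Generic n T s) (xh : Fin (n - 3) → ℂ)
    (hx : xh ∈ Udom n) (hc : IsCrit n (T.edges.erase (1, 2)) s xh) :
    (negHess n (T.edges.erase (1, 2)) s xh).det =
      ∏ k ∈ Finset.Icc 3 (n - 1),
        (brk n T s ((T.par k).1, k) / pc n xh (T.par k).1 k ^ 2
          + brk n T s ((T.par k).2, k) / pc n xh (T.par k).2 k ^ 2) := by
  rw [T.negHess_eq hx hn hc, Matrix.det_mul, Matrix.det_mul, Matrix.det_transpose,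
    T.det_triangleMat, one_mul, mul_one, Matrix.det_diagonal, TwoTree.prod_Icc_eq_prod_fin]

end
end MinKin
end

section
/- Let T be a 2-tree on [n−1], suppose the Mandelstam invariants s are generic for T, and let x̂ ∈ U be the unique critical point of the scattering potential L_T. Then the amplitude m_T = I_T(x̂)² / det 𝓗(x̂), where 𝓗 = −Hess(L_T) is the negated Hessian matrix, satisfies m_T = Π_{triangles {i,j,k} of T, i<j<k} ([s_{{i,k}}] + [s_{{j,k}}]) / ([s_{{i,k}}] · [s_{{j,k}}]). -/
namespace MinKin

noncomputable section

attribute [local instance] Classical.propDecidable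

open scoped BigOperators

section AuxiliaryLemmas

lemma edgesUpTo_two (par : ℕ → ℕ × ℕ) : edgesUpTo par 2 = {(1, 2)} := by
  simp [edgesUpTo]

lemma edgesUpTo_succ (par : ℕ → ℕ × ℕ) {k : ℕ} (hk : 2 ≤ k) :
    edgesUpTo par (k + 1) =
      edgesUpTo par k ∪ {((par (k + 1)).1, k + 1), ((par (k + 1)).2, k + 1)} := by
  have : ¬ k + 1 < 3 := by omega
  simp [edgesUpTo, this]

variable {n : ℕ}

lemma bounds_of_mem_edgesUpTo (T : TwoTree n) {N : ℕ} (hN : 2 ≤ N) (hNn : N ≤ n - 1)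
    {e : ℕ × ℕ} (he : e ∈ edgesUpTo T.par N) : 1 ≤ e.1 ∧ e.1 < e.2 ∧ e.2 ≤ N := by
  induction N, hN using Nat.le_induction generalizing e with
  | base => rw [edgesUpTo_two, Finset.mem_singleton] at he; simp [he]
  | succ k hk ih =>
    have hlt := T.lt (k + 1) (by omega) hNn
    have hpar := ih (by omega) (T.mem (k + 1) (by omega) hNn)
    rw [edgesUpTo_succ _ hk] at he
    simp only [Finset.mem_union, Finset.mem_insert, Finset.mem_singleton] at he
    rcases he with he | rfl | rfl
    · have := ih (by omega) he; omega
    · dsimp only; omega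
    · dsimp only; omega

lemma bounds_par (T : TwoTree n) {k : ℕ} (hk : 3 ≤ k) (hkn : k ≤ n - 1) :
    1 ≤ (T.par k).1 ∧ (T.par k).1 < (T.par k).2 ∧ (T.par k).2 < k := by
  have := bounds_of_mem_edgesUpTo T (by omega) (by omega) (T.mem k hk hkn)
  omega

lemma mem_edgesUpTo_iff (T : TwoTree n) {N : ℕ} (hN : 2 ≤ N) (e : ℕ × ℕ) :
    e ∈ edgesUpTo T.par N ↔ e = (1, 2) ∨
      ∃ k, 3 ≤ k ∧ k ≤ N ∧ (e = ((T.par k).1, k) ∨ e = ((T.par k).2, k)) := by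
  induction N, hN using Nat.le_induction with
  | base =>
    rw [edgesUpTo_two, Finset.mem_singleton]
    refine ⟨Or.inl, ?_⟩
    rintro (h | ⟨k, h3, h2, -⟩)
    · exact h
    · omega
  | succ N hN ih =>
    rw [edgesUpTo_succ _ hN, Finset.mem_union, ih]
    simp only [Finset.mem_insert, Finset.mem_singleton]
    constructor
    · rintro ((h | ⟨k, h3, hk, h⟩) | h)
      · exact Or.inl h
      · exact Or.inr ⟨k, h3, by omega, h⟩
      · exact Or.inr ⟨N + 1, by omega, le_rfl, h⟩
    · rintro (h | ⟨k, h3, hk, h⟩)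
      · exact Or.inl (Or.inl h)
      · rcases hk.eq_or_lt with rfl | hk
        · exact Or.inr h
        · exact Or.inl (Or.inr ⟨k, h3, by omega, h⟩)

lemma prod_edgesUpTo {M : Type*} [CommMonoid M] (T : TwoTree n) (f : ℕ × ℕ → M) {N : ℕ}
    (hN : 2 ≤ N) (hNn : N ≤ n - 1) :
    ∏ e ∈ edgesUpTo T.par N, f e =
      f (1, 2) * ∏ k ∈ Finset.Icc 3 N, (f ((T.par k).1, k) * f ((T.par k).2, k)) := by
  induction N, hN using Nat.le_induction with
  | base => rw [edgesUpTo_two]; simp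
  | succ N hN ih =>
    have hlt := T.lt (N + 1) (by omega) hNn
    have hdisj : Disjoint (edgesUpTo T.par N)
        {((T.par (N + 1)).1, N + 1), ((T.par (N + 1)).2, N + 1)} := by
      rw [Finset.disjoint_left]
      intro e he he'
      have hb := bounds_of_mem_edgesUpTo T hN (by omega) he
      simp only [Finset.mem_insert, Finset.mem_singleton] at he'
      rcases he' with rfl | rfl <;> dsimp only at hb <;> omega
    have hne : ((T.par (N + 1)).1, N + 1) ≠ ((T.par (N + 1)).2, N + 1) := by
      intro h
      have := congrArg Prod.fst h
      dsimp only at this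
      omega
    rw [edgesUpTo_succ _ hN, Finset.prod_union hdisj, ih (by omega), Finset.prod_pair hne,
      Finset.prod_Icc_succ_top (by omega), mul_assoc]

@[to_additive]
lemma prod_Icc_eq_prod_fin {M : Type*} [CommMonoid M] (hn : 4 ≤ n) (f : ℕ → M) :
    ∏ k ∈ Finset.Icc 3 (n - 1), f k = ∏ r : Fin (n - 3), f ((r : ℕ) + 3) := by
  rw [Fin.prod_univ_eq_prod_range (fun k => f (k + 3)) (n - 3), Finset.range_eq_Ico,
    Finset.prod_Ico_add' f 0 (n - 3) 3]
  refine Finset.prod_congr ?_ fun _ _ => rfl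
  ext k
  simp only [Finset.mem_Icc, Finset.mem_Ico]
  omega

lemma snd_le_of_reflTransGen (T : TwoTree n) {e f : ℕ × ℕ}
    (h : Relation.ReflTransGen (Child n T) e f) : e.2 ≤ f.2 := by
  induction h with
  | refl => exact le_rfl
  | tail _ hc ih =>
    obtain ⟨k, h3, hk, rfl, rfl | rfl⟩ := hc <;> have := T.lt k h3 hk <;> dsimp only <;> omega

lemma reflTransGen_child_iff (T : TwoTree n) {m : ℕ} (hm : 3 ≤ m) (hmn : m ≤ n - 1)
    {g : ℕ × ℕ} (hg : g = ((T.par m).1, m) ∨ g = ((T.par m).2, m)) (c : ℕ × ℕ) :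
    Relation.ReflTransGen (Child n T) c g ↔
      g = c ∨ Relation.ReflTransGen (Child n T) c (T.par m) := by
  rw [Relation.ReflTransGen.cases_tail_iff]
  refine or_congr Iff.rfl ⟨?_, fun h => ⟨_, h, m, hm, hmn, rfl, hg⟩⟩
  rintro ⟨b, hb, k, -, -, rfl, hk⟩
  have h1 : g.2 = k := by rcases hk with rfl | rfl <;> rfl
  have h2 : g.2 = m := by rcases hg with rfl | rfl <;> rfl
  rwa [← h2, h1]

/-- Telescoping along the ancestors of an edge. -/
lemma sum_ancestors (T : TwoTree n) (hn : 4 ≤ n) (f : ℕ × ℕ → ℂ) (hf : f (1, 2) = 0)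
    (g : ℕ × ℕ) (hg : g ∈ T.edges) :
    ∑ k ∈ Finset.Icc 3 (n - 1),
      ((if Relation.ReflTransGen (Child n T) ((T.par k).1, k) g
          then f ((T.par k).1, k) - f (T.par k) else 0) +
       (if Relation.ReflTransGen (Child n T) ((T.par k).2, k) g
          then f ((T.par k).2, k) - f (T.par k) else 0)) = f g := by
  obtain ⟨N, hN⟩ : ∃ N, g.2 = N := ⟨_, rfl⟩
  induction N using Nat.strong_induction_on generalizing g with
  | _ N ih =>
  subst hN
  rcases (mem_edgesUpTo_iff T (by omega) g).1 hg with rfl | ⟨m, hm, hmn, hgm⟩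
  · rw [hf]
    refine Finset.sum_eq_zero fun k hk => ?_
    have hk3 := (Finset.mem_Icc.1 hk).1
    rw [if_neg, if_neg, add_zero]
    all_goals
      intro h
      have := snd_le_of_reflTransGen T h
      dsimp only at this
      omega
  · have hp := bounds_par T hm hmn
    have hg2 : g.2 = m := by rcases hgm with rfl | rfl <;> rfl
    have hpm : T.par m ∈ T.edges := by
      rcases (mem_edgesUpTo_iff T (by omega) _).1 (T.mem m hm hmn) with h | ⟨k, h3, hk, h⟩
      · exact (mem_edgesUpTo_iff T (by omega) _).2 (Or.inl h)
      · exact (mem_edgesUpTo_iff T (by omega) _).2 (Or.inr ⟨k, h3, by omega, h⟩)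
    have hih := ih (T.par m).2 (by omega) (T.par m) hpm rfl
    have hstep : ∑ k ∈ Finset.Icc 3 (n - 1), (if k = m then f g - f (T.par m) else 0) =
        f g - f (T.par m) := by
      rw [Finset.sum_ite_eq', if_pos (Finset.mem_Icc.2 ⟨hm, hmn⟩)]
    rw [← add_sub_cancel (f (T.par m)) (f g), ← hstep]
    refine Eq.trans ?_ (congrArg (· + _) hih)
    rw [← Finset.sum_add_distrib]
    refine Finset.sum_congr rfl fun k _ => ?_
    simp only [reflTransGen_child_iff T hm hmn hgm]
    by_cases hkm : k = m
    · subst hkm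
      have hnot : ∀ a, ¬ Relation.ReflTransGen (Child n T) (a, k) (T.par k) := by
        intro a h
        have := snd_le_of_reflTransGen T h
        dsimp only at this
        omega
      simp only [hnot, or_false, if_false, if_true, add_zero, zero_add]
      rcases hgm with rfl | rfl
      · have : ((T.par k).1, k) ≠ ((T.par k).2, k) := by
          intro h; have := congrArg Prod.fst h; dsimp only at this; omega
        rw [if_pos rfl, if_neg this, add_zero]
      · have : ((T.par k).2, k) ≠ ((T.par k).1, k) := by
          intro h; have := congrArg Prod.fst h; dsimp only at this; omega
        rw [if_pos rfl, if_neg this, zero_add]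
    · have hnot : ∀ a, g ≠ (a, k) := by
        rintro a rfl
        exact hkm hg2
      simp only [hnot, false_or, if_neg hkm, add_zero]

/-- Rewriting a weighted sum over the edges as a sum over triangles, with brackets as weights. -/
lemma sum_edges_eq_sum_triangles (T : TwoTree n) (hn : 4 ≤ n) (s f : ℕ × ℕ → ℂ)
    (hf : f (1, 2) = 0) :
    ∑ e ∈ T.edges.erase (1, 2), s e * f e =
      ∑ k ∈ Finset.Icc 3 (n - 1),
        (brk n T s ((T.par k).1, k) * (f ((T.par k).1, k) - f (T.par k)) +
         brk n T s ((T.par k).2, k) * (f ((T.par k).2, k) - f (T.par k))) := by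
  rw [Finset.sum_erase _ (by rw [hf, mul_zero])]
  calc ∑ e ∈ T.edges, s e * f e
      = ∑ e ∈ T.edges, s e * ∑ k ∈ Finset.Icc 3 (n - 1),
        ((if Relation.ReflTransGen (Child n T) ((T.par k).1, k) e
            then f ((T.par k).1, k) - f (T.par k) else 0) +
         (if Relation.ReflTransGen (Child n T) ((T.par k).2, k) e
            then f ((T.par k).2, k) - f (T.par k) else 0)) :=
        Finset.sum_congr rfl fun e he => by rw [sum_ancestors T hn f hf e he]
    _ = _ := by
        simp only [Finset.mul_sum]
        rw [Finset.sum_comm]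
        refine Finset.sum_congr rfl fun k _ => ?_
        simp only [mul_add, Finset.sum_add_distrib, brk, dec, Finset.sum_filter,
          Finset.sum_mul, mul_ite, ite_mul, mul_zero, zero_mul]

/-- The indicator vector of the column `i` of `X` in the coordinates `x`. -/
def colInd (n i : ℕ) (l : Fin (n - 3)) : ℂ := if i = (l : ℕ) + 3 then 1 else 0

lemma dpc_eq {i j : ℕ} (hi : i < n) (hj : j < n) (l : Fin (n - 3)) :
    dpc n i j l = colInd n j l - colInd n i l := by
  simp [dpc, colA, colInd, hi.ne, hj.ne]

lemma pc_eq {i j : ℕ} (hi : i < n) (hj : j < n) (x : Fin (n - 3) → ℂ) :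
    pc n x i j = colB n x j - colB n x i := by
  simp [pc, colA, hi.ne, hj.ne]

lemma pc_last (hn : 4 ≤ n) {i : ℕ} (hi : i < n) (x : Fin (n - 3) → ℂ) : pc n x i n = 1 := by
  have h1 : n ≠ 1 := by omega
  have h2 : n ≠ 2 := by omega
  simp [pc, colA, colB, hi.ne, h1, h2]

lemma pc_one_two (hn : 4 ≤ n) (x : Fin (n - 3) → ℂ) : pc n x 1 2 = 1 := by
  rw [pc_eq (by omega) (by omega)]
  simp [colB]

lemma pc_ne_zero (hn : 4 ≤ n) {x : Fin (n - 3) → ℂ} (hx : x ∈ Udom n) {i j : ℕ} (hi : 1 ≤ i)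
    (hij : i < j) (hj : j < n) : pc n x i j ≠ 0 := by
  by_cases h : (i, j) = (1, 2)
  · obtain ⟨rfl, rfl⟩ := Prod.mk.inj h
    rw [pc_one_two hn]
    exact one_ne_zero
  · refine hx (i, j) ?_
    simp only [Sfin, Finset.mem_filter, Finset.mem_product, Finset.mem_Icc]
    exact ⟨⟨⟨hi, by omega⟩, by omega, by omega⟩, hij, h⟩

/-- The product over edges of the CHY integrand, rewritten over triangles. -/
lemma integrand_eq (T : TwoTree n) (hn : 4 ≤ n) {x : Fin (n - 3) → ℂ} (hx : x ∈ Udom n) :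
    integrand n T x = ∏ k ∈ Finset.Icc 3 (n - 1),
      (pc n x (T.par k).1 (T.par k).2 / (pc n x (T.par k).1 k * pc n x (T.par k).2 k)) := by
  set p : ℕ × ℕ → ℂ := fun e => pc n x e.1 e.2 with hp
  have htri : ∀ t ∈ triples n T, 1 ≤ t.1 ∧ t.1 < t.2.1 ∧ t.2.1 < t.2.2 ∧
      t.2.1 < n ∧ t.2.2 ≤ n := by
    intro t ht
    simp only [triples, Finset.mem_insert, Finset.mem_image, Finset.mem_Icc] at ht
    rcases ht with rfl | ⟨k, ⟨h3, hk⟩, rfl⟩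
    · dsimp only; omega
    · have := bounds_par T h3 hk
      dsimp only; omega
  have hne : ∀ i j, 1 ≤ i → i < j → j ≤ n → pc n x i j ≠ 0 := by
    intro i j hi hij hj
    rcases hj.eq_or_lt with rfl | hj
    · rw [pc_last hn hij]; exact one_ne_zero
    · exact pc_ne_zero hn hx hi hij hj
  have hpe : ∀ e ∈ diagEdges n T, p e ≠ 0 := by
    intro e he
    simp only [diagEdges, Finset.mem_biUnion, Finset.mem_insert, Finset.mem_singleton] at he
    obtain ⟨t, ht, he⟩ := he
    have := htri t ht
    rcases he with rfl | rfl | rfl <;> apply hne <;> dsimp only <;> omega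
  have hpow : ∏ e ∈ diagEdges n T, p e ^ vTil n T e =
      ∏ t ∈ triples n T, (p (t.1, t.2.1) * (p (t.1, t.2.2) * p (t.2.1, t.2.2))) := by
    calc ∏ e ∈ diagEdges n T, p e ^ vTil n T e
        = ∏ e ∈ diagEdges n T, ∏ t ∈ triples n T, if inTriple e t then p e else 1 := by
          refine Finset.prod_congr rfl fun e _ => ?_
          rw [← Finset.prod_filter, Finset.prod_const, vTil]
      _ = ∏ t ∈ triples n T, ∏ e ∈ diagEdges n T, if inTriple e t then p e else 1 :=
          Finset.prod_comm
      _ = _ := by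
          refine Finset.prod_congr rfl fun t ht => ?_
          have hb := htri t ht
          have hset : (diagEdges n T).filter (fun e => inTriple e t) =
              {(t.1, t.2.1), (t.1, t.2.2), (t.2.1, t.2.2)} := by
            ext e
            rw [Finset.mem_filter, diagEdges, Finset.mem_biUnion]
            simp only [Finset.mem_insert, Finset.mem_singleton]
            exact ⟨fun h => h.2, fun h => ⟨⟨t, ht, h⟩, h⟩⟩
          rw [← Finset.prod_filter, hset, Finset.prod_insert, Finset.prod_pair]
          · intro h; have := congrArg Prod.fst h; dsimp only at this; omega
          · simp only [Finset.mem_insert, Finset.mem_singleton, Prod.mk.injEq]; omega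
  have htriples : ∏ t ∈ triples n T, (p (t.1, t.2.1) * (p (t.1, t.2.2) * p (t.2.1, t.2.2))) =
      ∏ k ∈ Finset.Icc 3 (n - 1),
        (p (T.par k) * (p ((T.par k).1, k) * p ((T.par k).2, k))) := by
    rw [triples, Finset.prod_insert, Finset.prod_image]
    · simp only [hp, pc_last hn (show 1 < n by omega), pc_last hn (show 2 < n by omega),
        pc_one_two hn, one_mul]
    · intro a _ b _ h
      exact congrArg (fun t : ℕ × ℕ × ℕ => t.2.2) h
    · simp only [Finset.mem_image, Finset.mem_Icc, not_exists, not_and]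
      rintro k ⟨-, hk⟩ h
      have := congrArg (fun t : ℕ × ℕ × ℕ => t.2.2) h
      dsimp only at this
      omega
  have hedges : ∏ e ∈ diagEdges n T, (p e)⁻¹ =
      ∏ k ∈ Finset.Icc 3 (n - 1), ((p ((T.par k).1, k))⁻¹ * (p ((T.par k).2, k))⁻¹) := by
    have hsub : T.edges ⊆ diagEdges n T := by
      intro e he
      simp only [diagEdges, Finset.mem_biUnion, Finset.mem_insert, Finset.mem_singleton]
      rcases (mem_edgesUpTo_iff T (by omega) e).1 he with rfl | ⟨k, h3, hk, h⟩
      · exact ⟨(1, 2, n), Finset.mem_insert_self _ _, Or.inl rfl⟩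
      · exact ⟨_, Finset.mem_insert_of_mem
          (Finset.mem_image_of_mem _ (Finset.mem_Icc.2 ⟨h3, hk⟩)), Or.inr h⟩
    rw [← Finset.prod_subset hsub, TwoTree.edges, prod_edgesUpTo T _ (by omega) le_rfl]
    · simp only [hp, pc_one_two hn, inv_one, one_mul]
    · intro e he hne
      simp only [diagEdges, triples, Finset.mem_biUnion, Finset.mem_insert, Finset.mem_image,
        Finset.mem_Icc, Finset.mem_singleton] at he
      obtain ⟨t, rfl | ⟨k, ⟨h3, hk⟩, rfl⟩, he⟩ := he
      · rcases he with rfl | rfl | rfl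
        · simp [hp, pc_one_two hn]
        · simp [hp, pc_last hn (show 1 < n by omega)]
        · simp [hp, pc_last hn (show 2 < n by omega)]
      · refine absurd ((mem_edgesUpTo_iff T (by omega) e).2 ?_) hne
        rcases he with rfl | he
        · have hm := T.mem k h3 hk
          rcases (mem_edgesUpTo_iff T (by omega) _).1 hm with h | ⟨l, hl, hlk, h⟩
          · exact Or.inl h
          · exact Or.inr ⟨l, hl, by omega, h⟩
        · exact Or.inr ⟨k, h3, hk, he⟩
  calc integrand n T x
      = ∏ e ∈ diagEdges n T, (p e ^ vTil n T e * ((p e)⁻¹ * (p e)⁻¹)) := by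
        refine Finset.prod_congr rfl fun e he => ?_
        rw [zpow_sub₀ (hpe e he), zpow_natCast, div_eq_mul_inv, ← mul_inv, ← sq]
        rfl
    _ = _ := by
        rw [Finset.prod_mul_distrib, Finset.prod_mul_distrib, hpow, htriples, hedges,
          ← Finset.prod_mul_distrib, ← Finset.prod_mul_distrib]
        refine Finset.prod_congr rfl fun k hk => ?_
        obtain ⟨h3, hk⟩ := Finset.mem_Icc.1 hk
        have hb := bounds_par T h3 hk
        have h1 : p ((T.par k).1, k) ≠ 0 := hne _ _ (by omega) (by omega) (by omega)
        have h2 : p ((T.par k).2, k) ≠ 0 := hne _ _ (by omega) (by omega) (by omega)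
        change _ = p (T.par k) / (p ((T.par k).1, k) * p ((T.par k).2, k))
        field_simp

/-- The unitriangular matrix diagonalizing the Hessian as a quadratic form. -/
def triMat (n : ℕ) (T : TwoTree n) (x : Fin (n - 3) → ℂ) :
    Matrix (Fin (n - 3)) (Fin (n - 3)) ℂ :=
  Matrix.of fun r l =>
    colInd n (r + 3) l +
      pc n x (T.par (r + 3)).2 (r + 3) / pc n x (T.par (r + 3)).1 (T.par (r + 3)).2 *
        colInd n (T.par (r + 3)).1 l -
      pc n x (T.par (r + 3)).1 (r + 3) / pc n x (T.par (r + 3)).1 (T.par (r + 3)).2 *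
        colInd n (T.par (r + 3)).2 l

lemma det_triMat (T : TwoTree n) (x : Fin (n - 3) → ℂ) : (triMat n T x).det = 1 := by
  have hb : ∀ r : Fin (n - 3), (T.par (r + 3)).1 < r + 3 ∧ (T.par (r + 3)).2 < r + 3 := by
    intro r
    have := bounds_par T (k := r + 3) (by omega) (by omega)
    omega
  rw [Matrix.det_of_isLowerTriangular]
  · refine Finset.prod_eq_one fun r _ => ?_
    have := hb r
    simp [triMat, colInd, this.1.ne, this.2.ne]
  · intro r l hrl
    have hrl : (r : ℕ) < l := hrl
    have := hb r
    have h1 : (r : ℕ) + 3 ≠ l + 3 := by omega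
    have h2 : (T.par (r + 3)).1 ≠ (l : ℕ) + 3 := by omega
    have h3 : (T.par (r + 3)).2 ≠ (l : ℕ) + 3 := by omega
    simp only [triMat, Matrix.of_apply, colInd, if_neg h1, if_neg h2, if_neg h3]
    ring

lemma dpc_one_two (hn : 4 ≤ n) (l : Fin (n - 3)) : dpc n 1 2 l = 0 := by
  rw [dpc_eq (by omega) (by omega)]
  simp [colInd]

/-- The critical equations decouple: one equation for each triangle. -/
lemma brk_div_add_brk_div_eq_zero (T : TwoTree n) (hn : 4 ≤ n) (s : ℕ × ℕ → ℂ)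
    {x : Fin (n - 3) → ℂ} (hx : x ∈ Udom n) (hc : IsCrit n (T.edges.erase (1, 2)) s x)
    {k : ℕ} (hk : 3 ≤ k) (hkn : k ≤ n - 1) :
    brk n T s ((T.par k).1, k) / pc n x (T.par k).1 k +
      brk n T s ((T.par k).2, k) / pc n x (T.par k).2 k = 0 := by
  set C : Fin (n - 3) → ℂ := fun r =>
    brk n T s ((T.par (r + 3)).1, r + 3) / pc n x (T.par (r + 3)).1 (r + 3) +
      brk n T s ((T.par (r + 3)).2, r + 3) / pc n x (T.par (r + 3)).2 (r + 3) with hC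
  have hC0 : Matrix.vecMul C (triMat n T x) = 0 := by
    ext l
    have h := hc l
    simp only [mul_div_assoc] at h
    rw [sum_edges_eq_sum_triangles T hn s (fun e => dpc n e.1 e.2 l / pc n x e.1 e.2)
      (by simp [dpc_one_two hn]), sum_Icc_eq_sum_fin hn] at h
    rw [Matrix.vecMul, dotProduct, Pi.zero_apply, ← h]
    refine Finset.sum_congr rfl fun r _ => ?_
    have hb := bounds_par T (k := r + 3) (by omega) (by omega)
    have h1 := pc_ne_zero hn hx hb.1 hb.2.1 (by omega)
    have h2 := pc_ne_zero (j := r + 3) hn hx hb.1 (by omega) (by omega)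
    have h3 := pc_ne_zero (i := (T.par (r + 3)).2) (j := r + 3) hn hx
      (by omega) (by omega) (by omega)
    simp only [hC, triMat, Matrix.of_apply]
    rw [dpc_eq (by omega) (by omega), dpc_eq (by omega) (by omega),
      dpc_eq (by omega) (by omega)]
    have h4 : pc n x (T.par (r + 3)).1 (T.par (r + 3)).2 =
        pc n x (T.par (r + 3)).1 (r + 3) - pc n x (T.par (r + 3)).2 (r + 3) := by
      rw [pc_eq (by omega) (by omega), pc_eq (by omega) (by omega),
        pc_eq (by omega) (by omega)]
      ring
    rw [h4] at h1 ⊢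
    field_simp
    ring
  have hzero : C = 0 := by
    refine Matrix.eq_zero_of_vecMul_eq_zero ?_ hC0
    rw [det_triMat]
    exact one_ne_zero
  have := congrFun hzero ⟨k - 3, by omega⟩
  simpa [hC, show k - 3 + 3 = k by omega] using this

/-- At a critical point the negated Hessian is congruent to a diagonal matrix. -/
lemma negHess_eq (T : TwoTree n) (hn : 4 ≤ n) (s : ℕ × ℕ → ℂ)
    {x : Fin (n - 3) → ℂ} (hx : x ∈ Udom n) (hc : IsCrit n (T.edges.erase (1, 2)) s x) :
    negHess n (T.edges.erase (1, 2)) s x =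
      (triMat n T x).transpose * Matrix.diagonal (fun r : Fin (n - 3) =>
        brk n T s ((T.par (r + 3)).1, r + 3) / pc n x (T.par (r + 3)).1 (r + 3) ^ 2 +
        brk n T s ((T.par (r + 3)).2, r + 3) / pc n x (T.par (r + 3)).2 (r + 3) ^ 2) *
      triMat n T x := by
  ext l m
  rw [Matrix.mul_apply]
  simp only [negHess, Matrix.of_apply, mul_assoc, mul_div_assoc, Matrix.mul_diagonal,
    Matrix.transpose_apply]
  rw [sum_edges_eq_sum_triangles T hn s
    (fun e => dpc n e.1 e.2 l * (dpc n e.1 e.2 m / pc n x e.1 e.2 ^ 2))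
    (by simp [dpc_one_two hn]), sum_Icc_eq_sum_fin hn]
  refine Finset.sum_congr rfl fun r _ => ?_
  have hb := bounds_par T (k := r + 3) (by omega) (by omega)
  have hC := brk_div_add_brk_div_eq_zero T hn s hx hc (k := r + 3) (by omega) (by omega)
  have h1 := pc_ne_zero hn hx hb.1 hb.2.1 (by omega)
  have h2 := pc_ne_zero (j := r + 3) hn hx hb.1 (by omega) (by omega)
  have h3 := pc_ne_zero (i := (T.par (r + 3)).2) (j := r + 3) hn hx
    (by omega) (by omega) (by omega)
  simp only [triMat, Matrix.of_apply]
  rw [dpc_eq (by omega) (by omega), dpc_eq (by omega) (by omega),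
    dpc_eq (by omega) (by omega), dpc_eq (by omega) (by omega), dpc_eq (by omega) (by omega),
    dpc_eq (by omega) (by omega)]
  have h4 : pc n x (T.par (r + 3)).1 (T.par (r + 3)).2 =
      pc n x (T.par (r + 3)).1 (r + 3) - pc n x (T.par (r + 3)).2 (r + 3) := by
    rw [pc_eq (by omega) (by omega), pc_eq (by omega) (by omega),
      pc_eq (by omega) (by omega)]
    ring
  rw [h4] at h1 ⊢
  generalize pc n x (T.par (r + 3)).1 (r + 3) = P at *
  generalize pc n x (T.par (r + 3)).2 (r + 3) = Q at *
  generalize brk n T s ((T.par (r + 3)).1, r + 3) = A at *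
  generalize brk n T s ((T.par (r + 3)).2, r + 3) = B at *
  have hA : A = -(B * P / Q) := by
    field_simp at hC ⊢
    linear_combination hC
  rw [hA]
  field_simp
  ring

end AuxiliaryLemmas

/-- Theorem 4.1, 2-tree amplitudes: the amplitude
m_T = I_T(xh)²/det 𝓗(xh) equals Π_{triangles} ([s_{ik}]+[s_{jk}])/([s_{ik}]·[s_{jk}]). -/
theorem twoTree_amplitude (n : ℕ) (hn : 4 ≤ n) (T : TwoTree n)
    (s : ℕ × ℕ → ℂ) (hs : Generic n T s) (xh : Fin (n - 3) → ℂ)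
    (hx : xh ∈ Udom n) (hc : IsCrit n (T.edges.erase (1, 2)) s xh)
    (huniq : ∀ y : Fin (n - 3) → ℂ, y ∈ Udom n →
      IsCrit n (T.edges.erase (1, 2)) s y → y = xh) :
    integrand n T xh ^ 2 / (negHess n (T.edges.erase (1, 2)) s xh).det =
      ∏ k ∈ Finset.Icc 3 (n - 1),
        (brk n T s ((T.par k).1, k) + brk n T s ((T.par k).2, k))
          / (brk n T s ((T.par k).1, k) * brk n T s ((T.par k).2, k)) := by
  have hdet := congrArg Matrix.det (negHess_eq T hn s hx hc)
  rw [Matrix.det_mul, Matrix.det_mul, Matrix.det_transpose, det_triMat, Matrix.det_diagonal,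
    one_mul, mul_one, ← prod_Icc_eq_prod_fin hn (fun k =>
      brk n T s ((T.par k).1, k) / pc n xh (T.par k).1 k ^ 2 +
        brk n T s ((T.par k).2, k) / pc n xh (T.par k).2 k ^ 2)] at hdet
  rw [hdet, integrand_eq T hn hx, ← Finset.prod_pow, ← Finset.prod_div_distrib]
  refine Finset.prod_congr rfl fun k hk => ?_
  obtain ⟨hk3, hkn⟩ := Finset.mem_Icc.1 hk
  obtain ⟨hA, hB, hAB⟩ := hs k hk3 hkn
  have hb := bounds_par T hk3 hkn
  have hC := brk_div_add_brk_div_eq_zero T hn s hx hc hk3 hkn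
  have h1 := pc_ne_zero hn hx hb.1 hb.2.1 (by omega)
  have h2 := pc_ne_zero (j := k) hn hx hb.1 (by omega) (by omega)
  have h3 := pc_ne_zero (i := (T.par k).2) (j := k) hn hx (by omega) (by omega) (by omega)
  have h4 : pc n xh (T.par k).1 (T.par k).2 =
      pc n xh (T.par k).1 k - pc n xh (T.par k).2 k := by
    rw [pc_eq (by omega) (by omega), pc_eq (by omega) (by omega), pc_eq (by omega) (by omega)]
    ring
  rw [h4] at h1 ⊢
  generalize pc n xh (T.par k).1 k = P at *
  generalize pc n xh (T.par k).2 k = Q at *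
  generalize brk n T s ((T.par k).1, k) = A at *
  generalize brk n T s ((T.par k).2, k) = B at *
  have hlin : A * Q + B * P = 0 := by
    field_simp at hC
    linear_combination hC
  have hkey : (A / P ^ 2 + B / Q ^ 2) * (A + B) = A * B * ((P - Q) / (P * Q)) ^ 2 := by
    field_simp
    linear_combination (A * Q + B * P) * hlin
  have hD : A / P ^ 2 + B / Q ^ 2 ≠ 0 := by
    intro h0
    rw [h0, zero_mul] at hkey
    exact mul_ne_zero (mul_ne_zero hA hB)
      (pow_ne_zero 2 (div_ne_zero h1 (mul_ne_zero h2 h3))) hkey.symm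
  rw [div_eq_div_iff hD (mul_ne_zero hA hB)]
  linear_combination -hkey

end
end MinKin
end

section
/- Let T be a 2-tree on [n−1] and set Δ_T(x) = Π_e p_{ij}(x)^{ṽ(e)−1}, the product over all edges e = {i,j} contained in at least one triple of the on-shell diagram of T. Then for every pair 1 ≤ i < j ≤ n, the maximal minor of M_T obtained by deleting columns i and j equals ± p_{ij}(x)·Δ_T(x) in ℂ[x_1,…,x_{n−3}]. -/
namespace MinKin

noncomputable section

attribute [local instance] Classical.propDecidable

open scoped BigOperators

/-- If `X` has rows in the kernel of `M`, the complementary maximal minors of `M` and `X` are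
proportional up to sign. -/
theorem exists_unit_det_mul_det_eq {R m k q : Type*} [CommRing R] [Fintype m] [DecidableEq m]
    [Fintype k] [DecidableEq k] [Fintype q] (M : Matrix k q R) (X : Matrix m q R) (hMX : M * X.transpose = 0)
    (σ τ : m ⊕ k ≃ q) :
    ∃ ε : ℤˣ, ((ε : ℤ) : R) * (M.submatrix id (σ ∘ Sum.inr)).det *
        (X.submatrix id (τ ∘ Sum.inl)).det =
      (X.submatrix id (σ ∘ Sum.inl)).det * (M.submatrix id (τ ∘ Sum.inr)).det := by
  let E : Matrix q k R := (1 : Matrix q q R).submatrix id (τ ∘ Sum.inr)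
  let Q : Matrix q (m ⊕ k) R := Matrix.fromCols X.transpose E
  let B : Matrix (m ⊕ k) (m ⊕ k) R := Matrix.fromBlocks 1 0
    (M.submatrix id (σ ∘ Sum.inl)) (M.submatrix id (σ ∘ Sum.inr))
  have hB : B.det = (M.submatrix id (σ ∘ Sum.inr)).det := by
    simp [B, Matrix.det_fromBlocks_zero₁₂]
  have hQτ : Q.submatrix τ id = Matrix.fromBlocks (X.submatrix id (τ ∘ Sum.inl)).transpose 0
      (X.submatrix id (τ ∘ Sum.inr)).transpose 1 := by
    ext (a | a) (b | b) <;> simp [Q, E, Matrix.one_apply]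
  have hQσ : (Q.submatrix σ id).det =
      ((Equiv.Perm.sign (σ.trans τ.symm) : ℤ) : R) * (X.submatrix id (τ ∘ Sum.inl)).det := by
    have h : Q.submatrix σ id = (Q.submatrix τ id).submatrix (σ.trans τ.symm) id := by
      ext; simp
    rw [h, Matrix.det_permute, hQτ, Matrix.det_fromBlocks_zero₁₂, Matrix.det_one, mul_one,
      Matrix.det_transpose]
  have hBQ : B * Q.submatrix σ id = Matrix.fromBlocks (X.submatrix id (σ ∘ Sum.inl)).transpose
      (E.submatrix (σ ∘ Sum.inl) id) 0 (M.submatrix id (τ ∘ Sum.inr)) := by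
    have hsum : ∀ (r : k) (f : q → R), ∑ a, M r (σ (Sum.inl a)) * f (σ (Sum.inl a)) +
        ∑ a, M r (σ (Sum.inr a)) * f (σ (Sum.inr a)) = ∑ c, M r c * f c := fun r f => by
      rw [← σ.sum_comp, Fintype.sum_sum_type]
    ext (a | a) (b | b)
    · simp [B, Q, Matrix.mul_apply, Matrix.one_apply]
    · simp [B, Q, Matrix.mul_apply, Matrix.one_apply]
    · simpa [B, Q, Matrix.mul_apply] using
        (hsum a fun c => X b c).trans (congrFun (congrFun hMX a) b)
    · simpa [B, Q, E, Matrix.mul_apply, Matrix.one_apply] using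
        hsum a fun c => E c b
  refine ⟨Equiv.Perm.sign (σ.trans τ.symm), ?_⟩
  have h := congrArg Matrix.det hBQ
  rw [Matrix.det_mul, hB, hQσ, Matrix.det_fromBlocks_zero₂₁, Matrix.det_transpose] at h
  rw [← h]
  ring

/-- The equivalence splitting the columns into the positions `a < b` and the remaining ones. -/
def splitCols (n a b : ℕ) (hab : a < b) (hb : b < n) : Fin 2 ⊕ Fin (n - 2) ≃ Fin n :=
  Equiv.ofBijective (Sum.elim ![⟨a, hab.trans hb⟩, ⟨b, hb⟩] (delCols n a b)) <| by
    rw [Fintype.bijective_iff_injective_and_card]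
    constructor
    · refine Function.Injective.sumElim ?_ ?_ ?_
      · intro r s h
        fin_cases r <;> fin_cases s <;> simp_all <;> omega
      · intro d e h
        simp only [delCols, Fin.mk.injEq] at h
        ext
        split_ifs at h <;> omega
      · intro r d
        have := d.isLt
        fin_cases r <;> simp only [delCols, ne_eq, Fin.ext_iff] <;> simp <;> split_ifs <;> omega
    · simp only [Fintype.card_sum, Fintype.card_fin]
      omega

/-- The edges of a 2-tree other than `(1,2)` are attached together with their larger vertex. -/
theorem mem_edgesUpTo_s14 {par : ℕ → ℕ × ℕ} {m : ℕ} {e : ℕ × ℕ} (he : e ∈ edgesUpTo par m) :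
    e = (1, 2) ∨ 3 ≤ e.2 ∧ e.2 ≤ m ∧ (e.1 = (par e.2).1 ∨ e.1 = (par e.2).2) := by
  induction m with
  | zero => simp_all [edgesUpTo]
  | succ m ih =>
    rw [edgesUpTo] at he
    split_ifs at he with h
    · simp_all
    · simp only [Finset.mem_union, Finset.mem_insert, Finset.mem_singleton] at he
      rcases he with he | he | he
      · rcases ih he with h1 | h1
        · exact Or.inl h1
        · exact Or.inr ⟨h1.1, by omega, h1.2.2⟩
      · subst he
        exact Or.inr ⟨by simp only; omega, le_rfl, Or.inl rfl⟩
      · subst he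
        exact Or.inr ⟨by simp only; omega, le_rfl, Or.inr rfl⟩

theorem one_le_of_mem_edgesUpTo {n : ℕ} (T : TwoTree n) {m : ℕ} (hm : m ≤ n - 1) {e : ℕ × ℕ}
    (he : e ∈ edgesUpTo T.par m) : 1 ≤ e.1 := by
  induction m using Nat.strong_induction_on generalizing e with
  | _ m ih =>
    rcases mem_edgesUpTo_s14 he with rfl | ⟨h3, hle, h⟩
    · exact le_rfl
    · have h1 := ih (e.2 - 1) (by omega) (by omega) (T.mem e.2 h3 (by omega))
      have h2 := T.lt e.2 h3 (by omega)
      omega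

theorem one_le_par {n : ℕ} (T : TwoTree n) {k : ℕ} (h3 : 3 ≤ k) (hk : k ≤ n - 1) :
    1 ≤ (T.par k).1 :=
  one_le_of_mem_edgesUpTo T (by omega) (T.mem k h3 hk)

theorem tripleOf_bounds {n : ℕ} (hn : 4 ≤ n) (T : TwoTree n) (r : Fin (n - 2)) :
    1 ≤ (tripleOf n T r).1 ∧ (tripleOf n T r).1 < (tripleOf n T r).2.1 ∧
      (tripleOf n T r).2.1 < (tripleOf n T r).2.2 ∧ (tripleOf n T r).2.2 = r + 3 := by
  have := r.isLt
  unfold tripleOf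
  split_ifs with h
  · have := T.lt (r + 3) (by omega) h
    exact ⟨one_le_par T (by omega) h, this.1, this.2, rfl⟩
  · simp only
    omega

/-- The polynomial version of the 2×n matrix X. -/
def XmatP (n : ℕ) : Matrix (Fin 2) (Fin n) (MvPolynomial (Fin (n - 3)) ℂ) :=
  Matrix.of ![fun c => colAP n (c + 1), fun c => colBP n (c + 1)]

theorem sum_ite_succ_eq {R : Type*} [CommRing R] {n i j k : ℕ} (hi : 1 ≤ i) (hij : i < j)
    (hjk : j < k) (hk : k ≤ n) (a b c : R) (f : ℕ → R) :
    ∑ x : Fin n, (if (x : ℕ) + 1 = i then a else if (x : ℕ) + 1 = j then b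
      else if (x : ℕ) + 1 = k then c else 0) * f (x + 1) = a * f i + b * f j + c * f k := by
  have h : ∀ l : ℕ, 1 ≤ l → l ≤ n → ∀ u : R,
      ∑ x : Fin n, (if (x : ℕ) + 1 = l then u else 0) * f (x + 1) = u * f l := by
    intro l h1 hl u
    rw [Finset.sum_eq_single (⟨l - 1, by omega⟩ : Fin n)]
    · simp [Nat.sub_add_cancel h1]
    · intro x _ hx
      rw [if_neg (fun h => hx (Fin.ext (by simp only; omega))), zero_mul]
    · simp
  rw [← h i hi (by omega) a, ← h j (by omega) (by omega) b, ← h k (by omega) hk c,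
    ← Finset.sum_add_distrib, ← Finset.sum_add_distrib]
  refine Finset.sum_congr rfl fun x _ => ?_
  rw [← add_mul, ← add_mul]
  congr 1
  split_ifs <;> first | omega | simp

theorem Mmat_mul_transpose_XmatP {n : ℕ} (hn : 4 ≤ n) (T : TwoTree n) :
    Mmat n T * (XmatP n).transpose = 0 := by
  ext1 r s
  have hb := tripleOf_bounds hn T r
  have := r.isLt
  have key := sum_ite_succ_eq hb.1 hb.2.1 hb.2.2.1 (hb.2.2.2.trans_le (by omega) : _ ≤ n)
    (pcP n (tripleOf n T r).2.1 (tripleOf n T r).2.2)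
    (-pcP n (tripleOf n T r).1 (tripleOf n T r).2.2)
    (pcP n (tripleOf n T r).1 (tripleOf n T r).2.1)
  rw [Matrix.mul_apply]
  fin_cases s
  · refine (key (colAP n)).trans ?_
    simp only [pcP, Matrix.zero_apply]
    ring
  · refine (key (colBP n)).trans ?_
    simp only [pcP, Matrix.zero_apply]
    ring

theorem pcP_one_two {n : ℕ} (hn : 4 ≤ n) : pcP n 1 2 = 1 := by
  simp [pcP, colAP, colBP, show 1 ≠ n by omega, show 2 ≠ n by omega]

theorem maxMinor_one_two {n : ℕ} (hn : 4 ≤ n) (T : TwoTree n) :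
    maxMinor n T 1 2 = ∏ k ∈ Finset.Icc 3 (n - 1), pcP n (T.par k).1 (T.par k).2 := by
  have hdel : ∀ d : Fin (n - 2), (delCols n (1 - 1) (2 - 1) d : ℕ) = d + 2 := fun d => by
    simp [delCols]
  have hdiag : ∀ r : Fin (n - 2), Mmat n T r (delCols n (1 - 1) (2 - 1) r) =
      pcP n (tripleOf n T r).1 (tripleOf n T r).2.1 := fun r => by
    have hb := tripleOf_bounds hn T r
    rw [Mmat, Matrix.of_apply, hdel, if_neg (by omega), if_neg (by omega), if_pos (by omega)]
  rw [maxMinor, Matrix.det_of_isLowerTriangular]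
  · simp only [Matrix.of_apply, hdiag]
    rw [Fin.prod_univ_eq_prod_range
      (fun r => pcP n (tripleOf n T r).1 (tripleOf n T r).2.1) (n - 2),
      show n - 2 = (n - 3) + 1 by omega, Finset.prod_range_succ,
      show tripleOf n T (n - 3) = (1, 2, n) from if_neg (by omega), pcP_one_two hn, mul_one,
      ← Finset.Ico_add_one_right_eq_Icc, Finset.prod_Ico_eq_prod_range]
    refine Finset.prod_congr (by congr 1) fun r hr => ?_
    rw [Finset.mem_range] at hr
    rw [tripleOf, if_pos (by omega), add_comm 3 r]
  · intro r d hrd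
    have hb := tripleOf_bounds hn T r
    have hlt : (r : ℕ) < d := hrd
    rw [Matrix.of_apply, Mmat, Matrix.of_apply, hdel, if_neg (by omega), if_neg (by omega),
      if_neg (by omega)]

/-- Each edge of the diagram lies in one triple that introduces it, and otherwise only in the
triangles built on it. -/
theorem vTil_eq {n : ℕ} (hn : 4 ≤ n) (T : TwoTree n) {e : ℕ × ℕ} (he : e ∈ diagEdges n T) :
    vTil n T e = ((Finset.Icc 3 (n - 1)).filter fun k => T.par k = e).card + 1 := by
  have hcases : e = (1, 2) ∨ e = (1, n) ∨ e = (2, n) ∨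
      3 ≤ e.2 ∧ e.2 ≤ n - 1 ∧ (e.1 = (T.par e.2).1 ∨ e.1 = (T.par e.2).2) := by
    simp only [diagEdges, triples, Finset.mem_biUnion, Finset.mem_insert, Finset.mem_image,
      Finset.mem_Icc, Finset.mem_singleton] at he
    obtain ⟨t, rfl | ⟨k, ⟨h3, hk⟩, rfl⟩, ht⟩ := he
    · tauto
    · rcases ht with rfl | rfl | rfl
      · rcases mem_edgesUpTo_s14 (T.mem k h3 hk) with h | h
        · exact Or.inl h
        · exact Or.inr (Or.inr (Or.inr ⟨h.1, h.2.1.trans (by omega), h.2.2⟩))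
      · exact Or.inr (Or.inr (Or.inr ⟨h3, hk, Or.inl rfl⟩))
      · exact Or.inr (Or.inr (Or.inr ⟨h3, hk, Or.inr rfl⟩))
  let tri : ℕ → ℕ × ℕ × ℕ := fun k => ((T.par k).1, (T.par k).2, k)
  have htri : Function.Injective tri := fun k l h => congrArg (fun t => t.2.2) h
  let o : ℕ × ℕ × ℕ := if 3 ≤ e.2 ∧ e.2 ≤ n - 1 then tri e.2 else (1, 2, n)
  have hset : (triples n T).filter (inTriple e) =
      insert o (((Finset.Icc 3 (n - 1)).filter fun k => T.par k = e).image tri) := by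
    ext t
    simp only [triples, Finset.mem_filter, Finset.mem_insert, Finset.mem_image, Finset.mem_Icc]
    constructor
    · rintro ⟨rfl | ⟨k, ⟨h3, hk⟩, rfl⟩, hin⟩
      · left
        simp only [inTriple] at hin
        simp only [o]
        rw [if_neg]
        rintro ⟨h, h'⟩
        rcases hin with rfl | rfl | rfl <;> simp only at h h' <;> omega
      · rcases hin with h | h | h
        · exact Or.inr ⟨k, ⟨⟨h3, hk⟩, h.symm⟩, rfl⟩
        · left
          subst h
          simp only [o]
          rw [if_pos ⟨h3, hk⟩]
        · left
          subst h
          simp only [o]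
          rw [if_pos ⟨h3, hk⟩]
    · rintro (rfl | ⟨k, ⟨hk, rfl⟩, rfl⟩)
      · simp only [o]
        split_ifs with h
        · refine ⟨Or.inr ⟨e.2, h, rfl⟩, Or.inr ?_⟩
          rcases hcases with h' | h' | h' | ⟨-, -, h' | h'⟩
          · subst h'; simp only at h; omega
          · subst h'; simp only at h; omega
          · subst h'; simp only at h; omega
          · exact Or.inl (Prod.ext h' rfl)
          · exact Or.inr (Prod.ext h' rfl)
        · refine ⟨Or.inl rfl, ?_⟩
          simp only [inTriple]
          tauto
      · exact ⟨Or.inr ⟨k, hk, rfl⟩, Or.inl rfl⟩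
  have ho : o ∉ ((Finset.Icc 3 (n - 1)).filter fun k => T.par k = e).image tri := by
    simp only [Finset.mem_image, Finset.mem_filter, Finset.mem_Icc]
    rintro ⟨k, ⟨⟨h3, hk⟩, hpar⟩, hko⟩
    have hk2 := congrArg (fun t => t.2.2) hko
    have hlt := (T.lt k h3 hk).2
    rw [hpar] at hlt
    simp only [o] at hk2
    split_ifs at hk2
    · exact hlt.ne hk2.symm
    · simp only [tri] at hk2
      omega
  rw [vTil, hset, Finset.card_insert_of_notMem ho, Finset.card_image_of_injective _ htri]

theorem DeltaT_eq {n : ℕ} (hn : 4 ≤ n) (T : TwoTree n) :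
    DeltaT n T = ∏ k ∈ Finset.Icc 3 (n - 1), pcP n (T.par k).1 (T.par k).2 := by
  have hmaps : ∀ k ∈ Finset.Icc 3 (n - 1), T.par k ∈ diagEdges n T := fun k hk =>
    Finset.mem_biUnion.2 ⟨((T.par k).1, (T.par k).2, k),
      Finset.mem_insert_of_mem (Finset.mem_image_of_mem _ hk), by simp⟩
  rw [← Finset.prod_fiberwise_of_maps_to' hmaps fun e => pcP n e.1 e.2, DeltaT]
  refine Finset.prod_congr rfl fun e he => ?_
  rw [Finset.prod_const, vTil_eq hn T he, Nat.add_sub_cancel]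

/-- the maximal minor of M_T obtained by deleting columns i and j
equals ± p_{ij}·Δ_T. -/
theorem maximal_minor_formula (n : ℕ) (hn : 4 ≤ n) (T : TwoTree n) :
    ∀ i j : ℕ, 1 ≤ i → i < j → j ≤ n →
      maxMinor n T i j = pcP n i j * DeltaT n T ∨
        maxMinor n T i j = -(pcP n i j * DeltaT n T) := by
  intro i j hi hij hj
  have hdet : ∀ a b (ha : 1 ≤ a) (hab : a < b) (hb : b ≤ n),
      ((XmatP n).submatrix id (splitCols n (a - 1) (b - 1) (by omega) (by omega) ∘ Sum.inl)).det =
        pcP n a b := by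
    intro a b ha hab hb
    simp [Matrix.det_fin_two, XmatP, splitCols, pcP, Nat.sub_add_cancel ha,
      Nat.sub_add_cancel (ha.trans hab.le)]
  obtain ⟨ε, hε⟩ := exists_unit_det_mul_det_eq (Mmat n T) (XmatP n)
    (Mmat_mul_transpose_XmatP hn T) (splitCols n (i - 1) (j - 1) (by omega) (by omega))
    (splitCols n (1 - 1) (2 - 1) (by omega) (by omega))
  rw [hdet i j hi hij hj, hdet 1 2 le_rfl one_lt_two (by omega), pcP_one_two hn, mul_one] at hε
  change ((ε : ℤ) : MvPolynomial (Fin (n - 3)) ℂ) * maxMinor n T i j =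
    pcP n i j * maxMinor n T 1 2 at hε
  rw [maxMinor_one_two hn, ← DeltaT_eq hn] at hε
  rcases Int.units_eq_one_or ε with rfl | rfl
  · left
    simpa using hε
  · right
    rw [← hε]
    simp

end
end MinKin
end
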